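/- Let k = m·2^n with m odd, n ≥ 0, and m ≡ 7 (mod 8). Then the clipped Thue–Morse morphism f_{6·2^n, k} is cubefree. -/

import Mathlib

/-- The Thue–Morse word: `tm n` is the parity of the number of 1s in the
binary representation of `n` (`true` = letter 1, `false` = letter 0). -/
def tm (n : ℕ) : Bool := ((Nat.digits 2 n).count 1) % 2 == 1

/-- The factor `t[ℓ..ℓ+k-1]` of the Thue–Morse word. -/
def tmFactor (ℓ k : ℕ) : List Bool := (List.range k).map (fun i => tm (ℓ + i))

/-- Complement of a binary word (exchange 0 and 1 in every position). -/
def wcompl (w : List Bool) : List Bool := w.map (fun b => !b)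

/-- Apply the binary morphism `0 ↦ h0, 1 ↦ h1` to the word `w`. -/
def applyMorph (h0 h1 : List Bool) (w : List Bool) : List Bool :=
  (w.map (fun b => bif b then h1 else h0)).flatten

/-- The Thue–Morse morphism μ : 0 ↦ 01, 1 ↦ 10. -/
def mu : List Bool → List Bool := applyMorph [false, true] [true, false]

/-- `p` is a period of the finite word `w`: `1 ≤ p ≤ |w|` and `w[i] = w[i+p]`
for all `i` with `i + p < |w|`. -/
def HasPeriodW (w : List Bool) (p : ℕ) : Prop :=
  1 ≤ p ∧ p ≤ w.length ∧ ∀ i, i + p < w.length → w.getD i false = w.getD (i + p) false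

/-- The smallest period of `w`. -/
noncomputable def per (w : List Bool) : ℕ := sInf {p | HasPeriodW w p}

/-- The exponent of `w`: `|w| / per(w)`. -/
noncomputable def wexp (w : List Bool) : ℝ := (w.length : ℝ) / (per w : ℝ)

/-- The critical exponent of `w`: supremum of exponents of nonempty factors of `w`. -/
noncomputable def ce (w : List Bool) : ℝ :=
  sSup {r : ℝ | ∃ x : List Bool, x ≠ [] ∧ x <:+: w ∧ r = wexp x}

/-- A `k`-prefix: the length-`k` prefix of the Thue–Morse word, or its complement. -/
def kPrefix (k : ℕ) (s : List Bool) : Prop :=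
  s = tmFactor 0 k ∨ s = wcompl (tmFactor 0 k)

/-- `v` is a finite factor of the Thue–Morse word. -/
def IsTMFactor (v : List Bool) : Prop := ∃ ℓ, v = tmFactor ℓ v.length

/-- The complementary morphism `0 ↦ h0, 1 ↦ complement of h0` is cubefree:
it maps every word of critical exponent `< 3` to a word of critical exponent `< 3`. -/
def CubefreeC (h0 : List Bool) : Prop :=
  ∀ w : List Bool, ce w < 3 → ce (applyMorph h0 (wcompl h0) w) < 3

/-- The word `x` occurs at position `i` of the word `w`. -/
def OccursAt (x w : List Bool) (i : ℕ) : Prop :=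
  i + x.length ≤ w.length ∧ (w.drop i).take x.length = x

theorem tm_two_mul (x : ℕ) : tm (2 * x) = tm x := by
  rcases Nat.eq_zero_or_pos x with rfl | hx
  · rfl
  · unfold tm
    rw [Nat.digits_def' (by norm_num) (by omega : 0 < 2 * x)]
    have h1 : 2 * x % 2 = 0 := by omega
    have h2 : 2 * x / 2 = x := by omega
    rw [h1, h2, List.count_cons]
    simp

theorem tm_two_mul_add_one (x : ℕ) : tm (2 * x + 1) = !tm x := by
  unfold tm
  rw [Nat.digits_def' (by norm_num) (by omega : 0 < 2 * x + 1)]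
  have h1 : (2 * x + 1) % 2 = 1 := by omega
  have h2 : (2 * x + 1) / 2 = x := by omega
  rw [h1, h2, List.count_cons]
  generalize List.count 1 (Nat.digits 2 x) = n
  rcases Nat.mod_two_eq_zero_or_one n with h | h
  · have : (n + 1) % 2 = 1 := by omega
    simp [h, this]
  · have : (n + 1) % 2 = 0 := by omega
    simp [h, this]

/-- The length-`N` prefix of `g` contains no factor `xxx` with `x` nonempty. -/
def NoCube (g : ℕ → Bool) (N : ℕ) : Prop :=
  ∀ i p, 0 < p → i + 3 * p ≤ N → ¬ ∀ j, i ≤ j → j < i + 2 * p → g j = g (j + p)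

/-- If `g` is a concatenation of blocks `01` and `10`, it has no overlap of odd period. -/
theorem not_odd_overlap {g : ℕ → Bool} (hg : ∀ x, g (2 * x + 1) = !g (2 * x)) {i p : ℕ}
    (hp : p % 2 = 1) (h : ∀ j, i ≤ j → j ≤ i + p → g j = g (j + p)) : False := by
  have hpair : ∀ j, j % 2 = 0 → g (j + 1) = !g j := by
    intro j hj
    have := hg (j / 2)
    rwa [show 2 * (j / 2) = j by omega] at this
  have alt : ∀ d, d < p → g (i + d + 1) = !g (i + d) := by
    intro d hd
    rcases Nat.mod_two_eq_zero_or_one (i + d) with he | ho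
    · exact hpair _ he
    · have h1 := h (i + d) (by omega) (by omega)
      have h2 := h (i + d + 1) (by omega) (by omega)
      have h3 := hpair (i + d + p) (by omega)
      rw [h1, h2, ← h3]
      congr 1
      omega
  have key : ∀ d, d ≤ p → g (i + d) = xor (g i) (d % 2 == 1) := by
    intro d
    induction d with
    | zero => simp
    | succ d ih =>
      intro hd
      rw [← add_assoc, alt d (by omega), ih (by omega)]
      rcases Nat.mod_two_eq_zero_or_one d with he | ho
      · have : (d + 1) % 2 = 1 := by omega
        simp [he, this]
      · have : (d + 1) % 2 = 0 := by omega
        simp [ho, this]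
  have h0 := h i le_rfl (by omega)
  rw [key p le_rfl, hp] at h0
  simp at h0

/-- The Thue–Morse word is overlap-free. -/
theorem tm_overlap_free (p : ℕ) : ∀ i, 0 < p →
    ¬ ∀ j, i ≤ j → j ≤ i + p → tm j = tm (j + p) := by
  induction p using Nat.strong_induction_on with
  | _ p ih =>
    intro i hp h
    rcases Nat.mod_two_eq_zero_or_one p with he | ho
    · obtain ⟨p, rfl⟩ : ∃ p', p = 2 * p' := ⟨p / 2, by omega⟩
      refine ih p (by omega) (i / 2) (by omega) fun j hj hj' => ?_
      rcases Nat.mod_two_eq_zero_or_one i with hi | hi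
      · have := h (2 * j) (by omega) (by omega)
        rwa [← mul_add, tm_two_mul, tm_two_mul] at this
      · have := h (2 * j + 1) (by omega) (by omega)
        rw [show 2 * j + 1 + 2 * p = 2 * (j + p) + 1 by ring, tm_two_mul_add_one,
          tm_two_mul_add_one] at this
        simpa using this
    · refine not_odd_overlap (g := tm) (fun x => ?_) ho h
      rw [tm_two_mul_add_one, tm_two_mul]

/-- The Thue–Morse morphism preserves cubefreeness. -/
theorem NoCube.double {g g' : ℕ → Bool} {N : ℕ} (hg : NoCube g N)
    (h0 : ∀ x, g' (2 * x) = g x) (h1 : ∀ x, g' (2 * x + 1) = !g x) : NoCube g' (2 * N) := by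
  intro i p hp hN h
  rcases Nat.mod_two_eq_zero_or_one p with he | ho
  · obtain ⟨p, rfl⟩ : ∃ p', p = 2 * p' := ⟨p / 2, by omega⟩
    refine hg (i / 2) p (by omega) (by omega) fun j hj hj' => ?_
    rcases Nat.mod_two_eq_zero_or_one i with hi | hi
    · have := h (2 * j) (by omega) (by omega)
      rwa [← mul_add, h0, h0] at this
    · have := h (2 * j + 1) (by omega) (by omega)
      rw [show 2 * j + 1 + 2 * p = 2 * (j + p) + 1 by ring, h1, h1] at this
      simpa using this
  · rcases (by omega : p = 1 ∨ 2 ≤ p) with rfl | hp2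
    · have ha := h i le_rfl (by omega)
      have hb := h (i + 1) (by omega) (by omega)
      rcases Nat.mod_two_eq_zero_or_one i with hi | hi
      · obtain ⟨x, rfl⟩ : ∃ x, i = 2 * x := ⟨i / 2, by omega⟩
        rw [h0, h1] at ha
        simp at ha
      · obtain ⟨x, rfl⟩ : ∃ x, i = 2 * x + 1 := ⟨i / 2, by omega⟩
        rw [show 2 * x + 1 + 1 + 1 = 2 * (x + 1) + 1 by ring,
          show 2 * x + 1 + 1 = 2 * (x + 1) by ring, h0, h1] at hb
        simp at hb
    · exact not_odd_overlap (g := g') (fun x => by rw [h0, h1]) ho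
        fun j hj hj' => h j hj (by omega)

theorem tm_six_add_pair (x : ℕ) (hx : x % 2 = 0) : tm (6 + x) ≠ tm (6 + (x + 1)) := by
  rw [show 6 + x = 2 * (3 + x / 2) by omega, show 6 + (x + 1) = 2 * (3 + x / 2) + 1 by omega,
    tm_two_mul, tm_two_mul_add_one]
  simp

theorem tm_eight_mul (x : ℕ) : tm (8 * x) = tm x ∧ tm (8 * x + 1) = !tm x ∧
    tm (8 * x + 2) = !tm x ∧ tm (8 * x + 3) = tm x ∧ tm (8 * x + 4) = !tm x := by
  refine ⟨?_, ?_, ?_, ?_, ?_⟩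
  · rw [show 8 * x = 2 * (2 * (2 * x)) by ring]
    simp only [tm_two_mul]
  · rw [show 8 * x + 1 = 2 * (2 * (2 * x)) + 1 by ring]
    simp only [tm_two_mul, tm_two_mul_add_one]
  · rw [show 8 * x + 2 = 2 * (2 * (2 * x) + 1) by ring]
    simp only [tm_two_mul, tm_two_mul_add_one]
  · rw [show 8 * x + 3 = 2 * (2 * (2 * x) + 1) + 1 by ring]
    simp only [tm_two_mul, tm_two_mul_add_one, Bool.not_not]
  · rw [show 8 * x + 4 = 2 * (2 * (2 * x + 1)) by ring]
    simp only [tm_two_mul, tm_two_mul_add_one]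

/-- The properties of the block `F = t[6..6+m-1]` used in the synchronization argument. -/
structure BlockData (F : ℕ → Bool) (m : ℕ) : Prop where
  odd : m % 2 = 1
  seven_le : 7 ≤ m
  pair : ∀ x, x % 2 = 0 → F x ≠ F (x + 1)
  overlap_free : ∀ i p, 0 < p → ¬ ∀ j, i ≤ j → j ≤ i + p → F j = F (j + p)
  pref : F 0 = false ∧ F 1 = true ∧ F 2 = true ∧ F 3 = false ∧ F 4 = false ∧ F 5 = true ∧
    F 6 = false
  suff : F (m - 4) = (!F (m - 5)) ∧ F (m - 3) = (!F (m - 5)) ∧ F (m - 2) = F (m - 5) ∧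
    F (m - 1) = !F (m - 5)

theorem blockData_tm {m : ℕ} (hm : m % 8 = 7) : BlockData (fun x => tm (6 + x)) m where
  odd := by omega
  seven_le := by omega
  pair := tm_six_add_pair
  overlap_free i p hp h := by
    refine tm_overlap_free p (6 + i) hp fun j hj hj' => ?_
    have := h (j - 6) (by omega) (by omega)
    rwa [show 6 + (j - 6) = j by omega, show 6 + (j - 6 + p) = j + p by omega] at this
  pref := by refine ⟨?_, ?_, ?_, ?_, ?_, ?_, ?_⟩ <;> norm_num [tm]
  suff := by
    obtain ⟨h0, h1, h2, h3, h4⟩ := tm_eight_mul (m / 8 + 1)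
    rw [show 6 + (m - 4) = 8 * (m / 8 + 1) + 1 by omega,
      show 6 + (m - 3) = 8 * (m / 8 + 1) + 2 by omega,
      show 6 + (m - 2) = 8 * (m / 8 + 1) + 3 by omega,
      show 6 + (m - 1) = 8 * (m / 8 + 1) + 4 by omega,
      show 6 + (m - 5) = 8 * (m / 8 + 1) by omega, h0, h1, h2, h3, h4]
    exact ⟨rfl, rfl, rfl, rfl⟩

namespace BlockData

variable {F : ℕ → Bool} {m : ℕ}

/-- A long prefix does not occur at an odd distance, even up to complement. -/
theorem not_prefix_shift_odd (hF : BlockData F m) {r : ℕ} (hr : r % 2 = 1) {e : Bool}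
    (h : ∀ o, o < 3 → F o = xor e (F (o + r))) : False := by
  have h1 := h 1 (by omega)
  have h2 := h 2 (by omega)
  have h3 := hF.pair (1 + r) (by omega)
  obtain ⟨-, p1, p2, -⟩ := hF.pref
  rw [show 1 + r + 1 = 2 + r by omega] at h3
  rw [p1] at h1
  rw [p2, h1] at h2
  exact h3 (by simpa using h2)

/-- A long suffix does not occur at an odd distance, even up to complement. -/
theorem not_suffix_shift_odd (hF : BlockData F m) {r : ℕ} (hr : r % 2 = 1) {e : Bool}
    (hrm : r + 4 ≤ m)
    (h : ∀ o, m - 4 ≤ o → o < m → F o = xor e (F (o - r))) : False := by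
  have := hF.seven_le
  have hodd := hF.odd
  have h1 := h (m - 4) (by omega) (by omega)
  have h2 := h (m - 3) (by omega) (by omega)
  have h3 := hF.pair (m - 4 - r) (by omega)
  obtain ⟨p1, p2, -⟩ := hF.suff
  rw [show m - 4 - r + 1 = m - 3 - r by omega] at h3
  rw [p1] at h1
  rw [p2, h1] at h2
  exact h3 (by simpa using h2)

theorem not_prefix_shift_two (hF : BlockData F m) {e : Bool}
    (h : ∀ o, o < 5 → F o = xor e (F (o + 2))) : False := by
  have h1 := h 0 (by omega)
  have h2 := h 4 (by omega)
  obtain ⟨p0, -, p2, -, p4, -, p6⟩ := hF.pref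
  simp only [zero_add, p0, p2, p4, p6, Nat.reduceAdd] at h1 h2
  revert h1 h2
  cases e <;> decide

theorem not_suffix_shift_two (hF : BlockData F m) {e : Bool}
    (h : ∀ o, m - 3 ≤ o → o < m → F o = xor e (F (o - 2))) : False := by
  have := hF.seven_le
  have h1 := h (m - 3) (by omega) (by omega)
  have h2 := h (m - 1) (by omega) (by omega)
  obtain ⟨p4, p3, p2, p1⟩ := hF.suff
  rw [show m - 3 - 2 = m - 5 by omega, p3] at h1
  rw [show m - 1 - 2 = m - 3 by omega, p1, p3] at h2
  revert h1 h2
  cases e <;> cases F (m - 5) <;> decide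

/-- A block does not occur out of phase in a concatenation of two blocks
(each block being taken up to complement). -/
theorem synchronizing (hF : BlockData F m) {r : ℕ} (h0 : 0 < r) (hr : r < m) {e₁ e₂ : Bool}
    (h₁ : ∀ o, o < m - r → F o = xor e₁ (F (o + r)))
    (h₂ : ∀ o, o < r → F o = xor e₂ (F (o + (m - r)))) : False := by
  have hodd := hF.odd
  have h7 := hF.seven_le
  rcases Nat.mod_two_eq_zero_or_one r with he | ho
  · by_cases h : 3 ≤ r
    · exact hF.not_prefix_shift_odd (r := m - r) (by omega) fun o ho => h₂ o (by omega)
    · obtain rfl : r = 2 := by omega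
      exact hF.not_prefix_shift_two fun o ho => h₁ o (by omega)
  · by_cases h : 3 ≤ m - r
    · exact hF.not_prefix_shift_odd ho fun o ho => h₁ o (by omega)
    · have h2 : m - r = 2 := by omega
      rw [h2] at h₂
      exact hF.not_prefix_shift_two fun o ho => h₂ o (by omega)

/-- No cube of period less than `m` meets exactly one block boundary. -/
theorem no_cube_one_boundary (hF : BlockData F m) {a b p : ℕ} {e : Bool} (hp : 0 < p)
    (hab : a + b = 3 * p) (ham : a ≤ m) (hpm : p < m)
    (hl : ∀ x, m - a ≤ x → x + p < m → F x = F (x + p))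
    (hc : ∀ o, o < p → m - a ≤ o + (m - p) → o < b → F o = xor e (F (o + (m - p))))
    (hr : ∀ x, x + p < b → F x = F (x + p)) : False := by
  have hodd := hF.odd
  have h7 := hF.seven_le
  obtain ⟨f0, f1, f2, f3, f4, f5, f6⟩ := hF.pref
  obtain ⟨s4, s3, s2, s1⟩ := hF.suff
  have ha2 : a ≤ 2 * p := by
    by_contra! h
    exact hF.overlap_free (m - a) p hp fun j hj hj' => hl j hj (by omega)
  have hb2 : b ≤ 2 * p := by
    by_contra! h
    exact hF.overlap_free 0 p hp fun j hj hj' => hr j (by omega)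
  have hc' : ∀ o, o < p → F o = xor e (F (o + (m - p))) := fun o ho =>
    hc o ho (by omega) (by omega)
  rcases (by omega : p = 1 ∨ p = 2 ∨ 3 ≤ p) with rfl | rfl | h3
  · rcases (by omega : 2 ≤ b ∨ 2 ≤ a) with h | h
    · have := hr 0 (by omega)
      simp_all
    · have := hl (m - 2) (by omega) (by omega)
      rw [show m - 2 + 1 = m - 1 by omega] at this
      simp_all
  · rcases (by omega : 3 ≤ b ∨ 4 ≤ a) with h | h
    · have := hr 0 (by omega)
      simp_all
    · have := hl (m - 4) (by omega) (by omega)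
      rw [show m - 4 + 2 = m - 2 by omega] at this
      simp_all
  · rcases Nat.mod_two_eq_zero_or_one p with he | ho
    · exact hF.not_prefix_shift_odd (r := m - p) (by omega) fun o ho => hc' o (by omega)
    · have hb3 : b ≤ p + 2 := by
        by_contra! h
        refine hF.not_prefix_shift_odd (e := false) ho fun o ho => ?_
        simpa using hr o (by omega)
      have ha3 : a ≤ p + 3 := by
        by_contra! h
        refine hF.not_suffix_shift_odd (e := false) ho (by omega) fun o ho ho' => ?_
        have := hl (o - p) (by omega) (by omega)
        rw [show o - p + p = o by omega] at this
        simpa using this.symm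
      rcases (by omega : p = 3 ∨ p = 5) with rfl | rfl
      · have c1 := hc' 1 (by omega)
        have c2 := hc' 2 (by omega)
        rw [show 1 + (m - 3) = m - 2 by omega] at c1
        rw [show 2 + (m - 3) = m - 1 by omega] at c2
        rw [f1, s2] at c1
        rw [f2, s1] at c2
        revert c1 c2
        cases e <;> cases F (m - 5) <;> decide
      · have := hr 0 (by omega)
        simp_all

/-- No cube has a period `p < m` and its middle third strictly inside a block whose two
boundaries it crosses. -/
theorem no_cube_two_boundaries (hF : BlockData F m) {a b p : ℕ} {e₁ e₂ : Bool} (hp : 0 < p)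
    (hab : a + m + b = 3 * p) (hap : a < p) (hbp : b < p) (hpm : p < m)
    (hl : ∀ o, m - a ≤ o → o < m → F o = xor e₁ (F (o - (m - p))))
    (hc : ∀ x, x + p < m → F x = F (x + p))
    (hr : ∀ o, o < b → F o = xor e₂ (F (o + (m - p)))) : False := by
  have hodd := hF.odd
  have h7 := hF.seven_le
  have hm2 : m ≤ 2 * p := by
    by_contra! h
    exact hF.overlap_free 0 p hp fun j hj hj' => hc j (by omega)
  rcases Nat.mod_two_eq_zero_or_one p with he | ho
  · have hb : b ≤ 2 := by
      by_contra! h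
      exact hF.not_prefix_shift_odd (r := m - p) (by omega) fun o ho => hr o (by omega)
    have ha : a ≤ 3 := by
      by_contra! h
      exact hF.not_suffix_shift_odd (r := m - p) (by omega) (by omega)
        fun o ho ho' => hl o (by omega) ho'
    obtain rfl : p = 4 := by omega
    obtain rfl : m = 7 := by omega
    have := hc 2 (by omega)
    obtain ⟨f0, f1, f2, f3, f4, f5, f6⟩ := hF.pref
    simp_all
  · have h2 : m - p = 2 := by
      by_contra! h
      refine hF.not_prefix_shift_odd (e := false) ho fun o ho => ?_
      simpa using hc o (by omega)
    rw [h2] at hl hr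
    have hb : b ≤ 4 := by
      by_contra! h
      exact hF.not_prefix_shift_two fun o ho => hr o (by omega)
    have ha : a ≤ 2 := by
      by_contra! h
      exact hF.not_suffix_shift_two fun o ho ho' => hl o (by omega) ho'
    omega

/-- No cube of period less than `m` occurs in a concatenation of blocks. -/
theorem no_short_cube (hF : BlockData F m) {i p : ℕ} {e₁ e₂ : Bool} (hp : 0 < p) (hpm : p < m)
    (hi : i < m)
    (h0 : ∀ x, i ≤ x → x < i + 2 * p → x + p < m → F x = F (x + p))
    (h01 : ∀ x, i ≤ x → x < i + 2 * p → x < m → m ≤ x + p → F x = xor e₁ (F (x + p - m)))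
    (h1 : ∀ y, m + y < i + 2 * p → y + p < m → F y = F (y + p))
    (h12 : ∀ y, m + y < i + 2 * p → y < m → m ≤ y + p → F y = xor e₂ (F (y + p - m))) :
    False := by
  have flip : ∀ {e x y : Bool}, x = xor e y → y = xor e x := by decide
  by_cases hz : i + 3 * p ≤ m
  · exact hF.overlap_free i p hp fun j hj hj' => h0 j hj (by omega) (by omega)
  by_cases ho : i + 3 * p ≤ 2 * m
  · refine hF.no_cube_one_boundary (a := m - i) (b := i + 3 * p - m) (e := e₁) hp (by omega)
      (by omega) hpm (fun x hx hx' => h0 x (by omega) (by omega) hx')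
      (fun o ho ho' hob => ?_) (fun x hx => h1 x (by omega) (by omega))
    have := h01 (o + (m - p)) (by omega) (by omega) (by omega) (by omega)
    rw [show o + (m - p) + p - m = o by omega] at this
    exact flip this
  by_cases hA : 2 * m ≤ i + 2 * p
  · refine hF.synchronizing (e₁ := false) (e₂ := e₂) hp hpm (fun o ho => ?_) (fun o ho => ?_)
    · simpa using h1 o (by omega) (by omega)
    · have := h12 (o + (m - p)) (by omega) (by omega) (by omega)
      rw [show o + (m - p) + p - m = o by omega] at this
      exact flip this
  by_cases hB : i + p ≤ m
  · refine hF.synchronizing (e₁ := false) (e₂ := e₁) hp hpm (fun o ho => ?_) (fun o ho => ?_)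
    · simpa using h1 o (by omega) (by omega)
    · have := h01 (o + (m - p)) (by omega) (by omega) (by omega) (by omega)
      rw [show o + (m - p) + p - m = o by omega] at this
      exact flip this
  · refine hF.no_cube_two_boundaries (a := m - i) (b := i + 3 * p - 2 * m) (e₁ := e₁) (e₂ := e₂)
      hp (by omega) (by omega) (by omega) hpm (fun o ho ho' => ?_)
      (fun x hx => h1 x (by omega) hx) (fun o ho => ?_)
    · have := h01 o (by omega) (by omega) (by omega) (by omega)
      rwa [show o + p - m = o - (m - p) by omega] at this
    · have := h12 (o + (m - p)) (by omega) (by omega) (by omega)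
      rw [show o + (m - p) + p - m = o by omega] at this
      exact flip this

/-- The uniform complementary morphism with block `F` preserves cubefreeness. -/
theorem noCube (hF : BlockData F m) {w : ℕ → Bool} {L : ℕ} (hw : NoCube w L) :
    NoCube (fun j => xor (w (j / m)) (F (j % m))) (m * L) := by
  have h7 := hF.seven_le
  have hm : 0 < m := by omega
  intro i p hp hN h
  have rel : ∀ d x d' x', x < m → x' < m → i ≤ d * m + x → d * m + x < i + 2 * p →
      d' * m + x' = d * m + x + p → F x = xor (xor (w d) (w d')) (F x') := by
    intro d x d' x' hx hx' hl hu he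
    have := h (d * m + x) hl hu
    rw [← he] at this
    have e1 : ∀ d x, x < m → (d * m + x) / m = d := fun d x hx => by
      rw [mul_comm, Nat.mul_add_div hm, Nat.div_eq_of_lt hx, add_zero]
    have e2 : ∀ d x, x < m → (d * m + x) % m = x := fun d x hx => by
      rw [mul_comm, Nat.mul_add_mod, Nat.mod_eq_of_lt hx]
    simp only [e1 _ _ hx, e1 _ _ hx', e2 _ _ hx, e2 _ _ hx'] at this
    revert this
    cases w d <;> cases w d' <;> cases F x <;> cases F x' <;> decide
  obtain ⟨c, o, ho, rfl⟩ : ∃ c o, o < m ∧ i = c * m + o :=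
    ⟨i / m, i % m, Nat.mod_lt _ hm, by rw [mul_comm]; exact (Nat.div_add_mod i m).symm⟩
  have c1 : (c + 1) * m = c * m + m := by ring
  have c2 : (c + 2) * m = c * m + 2 * m := by ring
  obtain ⟨s, r, hr, rfl⟩ : ∃ s r, r < m ∧ p = s * m + r :=
    ⟨p / m, p % m, Nat.mod_lt _ hm, by rw [mul_comm]; exact (Nat.div_add_mod p m).symm⟩
  rcases Nat.eq_zero_or_pos r with rfl | hr0
  · have hs : 0 < s := Nat.pos_of_ne_zero fun h0 => by simp [h0] at hp
    refine hw c s hs ?_ fun d hd hd' => ?_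
    · have : (c + 3 * s) * m ≤ L * m := by nlinarith
      exact Nat.le_of_mul_le_mul_right this hm
    · have hds : (d + s) * m = d * m + s * m := by ring
      rcases Nat.eq_or_lt_of_le hd with rfl | hlt
      · have := rel c o (c + s) o ho ho le_rfl (by omega) (by omega)
        revert this
        cases w c <;> cases w (c + s) <;> cases F o <;> decide
      · have hl : (c + 1) * m ≤ d * m := Nat.mul_le_mul_right m hlt
        have hu : (d + 1) * m ≤ (c + 2 * s) * m := Nat.mul_le_mul_right m hd'
        have hu1 : (d + 1) * m = d * m + m := by ring
        have hu2 : (c + 2 * s) * m = c * m + 2 * (s * m) := by ring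
        have := rel d 0 (d + s) 0 hm hm (by omega) (by omega) (by omega)
        revert this
        cases w d <;> cases w (d + s) <;> cases F 0 <;> decide
  · rcases Nat.eq_zero_or_pos s with rfl | hs
    · simp only [zero_mul, zero_add] at *
      refine hF.no_short_cube (i := o) hr0 hr ho
        (e₁ := xor (w c) (w (c + 1))) (e₂ := xor (w (c + 1)) (w (c + 2)))
        (fun x hx hx' hx2 => ?_) (fun x hx hx' hx2 hx3 => ?_) (fun y hy hy' => ?_)
        (fun y hy hy' hy2 => ?_)
      · simpa using rel c x c (x + r) (by omega) hx2 (by omega) (by omega) (by omega)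
      · exact rel c x (c + 1) (x + r - m) hx2 (by omega) (by omega) (by omega) (by omega)
      · simpa using rel (c + 1) y (c + 1) (y + r) (by omega) hy' (by omega) (by omega) (by omega)
      · exact rel (c + 1) y (c + 2) (y + r - m) hy' (by omega) (by omega) (by omega) (by omega)
    · have hsm : m ≤ s * m := Nat.le_mul_of_pos_left m hs
      have d1 : (c + 1 + s) * m = c * m + m + s * m := by ring
      have d2 : (c + 2 + s) * m = c * m + 2 * m + s * m := by ring
      refine hF.synchronizing hr0 hr (e₁ := xor (w (c + 1)) (w (c + 1 + s)))
        (e₂ := xor (w (c + 1)) (w (c + 2 + s))) (fun x hx => ?_) (fun x hx => ?_)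
      · exact rel (c + 1) x (c + 1 + s) (x + r) (by omega) (by omega) (by omega) (by omega)
          (by omega)
      · have := rel (c + 1) (x + (m - r)) (c + 2 + s) x (by omega) (by omega) (by omega)
          (by omega) (by omega)
        revert this
        cases w (c + 1) <;> cases w (c + 2 + s) <;> cases F x <;> cases F (x + (m - r)) <;> decide

end BlockData

theorem noCube_clipped {m : ℕ} (hm8 : m % 8 = 7) {w : ℕ → Bool} {L : ℕ} (hw : NoCube w L)
    (n : ℕ) :
    NoCube (fun j => xor (w (j / (m * 2 ^ n))) (tm (6 * 2 ^ n + j % (m * 2 ^ n))))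
      (m * 2 ^ n * L) := by
  induction n with
  | zero => simpa using (blockData_tm hm8).noCube hw
  | succ n ih =>
    have e : m * 2 ^ (n + 1) = 2 * (m * 2 ^ n) := by ring
    have e6 : 6 * 2 ^ (n + 1) = 2 * (6 * 2 ^ n) := by ring
    rw [e, e6, mul_assoc]
    refine ih.double (fun x => ?_) (fun x => ?_)
    · simp only [Nat.mul_div_mul_left x (m * 2 ^ n) two_pos, Nat.mul_mod_mul_left, ← mul_add,
        tm_two_mul]
    · have hd : (2 * x + 1) / (2 * (m * 2 ^ n)) = x / (m * 2 ^ n) := by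
        rw [← Nat.div_div_eq_div_mul]
        congr 1
        omega
      have hmod : (2 * x + 1) % (2 * (m * 2 ^ n)) = 2 * (x % (m * 2 ^ n)) + 1 := by
        rw [Nat.mod_mul, show (2 * x + 1) % 2 = 1 by omega, show (2 * x + 1) / 2 = x by omega]
        ring
      simp only [hd, hmod, ← add_assoc, ← mul_add, tm_two_mul_add_one, Bool.xor_not]

theorem hasPeriodW_length {x : List Bool} (hx : x ≠ []) : HasPeriodW x x.length :=
  ⟨List.length_pos_of_ne_nil hx, le_rfl, fun i hi => by omega⟩

theorem hasPeriodW_per {x : List Bool} (hx : x ≠ []) : HasPeriodW x (per x) :=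
  Nat.sInf_mem (s := {p | HasPeriodW x p}) ⟨_, hasPeriodW_length hx⟩

theorem three_le_wexp_iff {x : List Bool} (hx : x ≠ []) :
    3 ≤ wexp x ↔ 3 * per x ≤ x.length := by
  have h : (0 : ℝ) < per x := by exact_mod_cast (hasPeriodW_per hx).1
  rw [wexp, le_div_iff₀ h]
  exact_mod_cast Iff.rfl

theorem ce_lt_three_iff (w : List Bool) :
    ce w < 3 ↔ ∀ x : List Bool, x ≠ [] → x <:+: w → ¬ 3 * per x ≤ x.length := by
  have hfin : {r : ℝ | ∃ x : List Bool, x ≠ [] ∧ x <:+: w ∧ r = wexp x}.Finite := by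
    refine ((List.finite_toSet w.sublists).image wexp).subset ?_
    rintro r ⟨x, -, hx, rfl⟩
    exact ⟨x, List.mem_sublists.2 hx.sublist, rfl⟩
  constructor
  · intro h x hx hxw hle
    have : wexp x ≤ ce w := le_csSup hfin.bddAbove ⟨x, hx, hxw, rfl⟩
    linarith [(three_le_wexp_iff hx).2 hle]
  · intro h
    rcases Set.eq_empty_or_nonempty
      {r : ℝ | ∃ x : List Bool, x ≠ [] ∧ x <:+: w ∧ r = wexp x} with he | hne
    · rw [ce, he, Real.sSup_empty]
      norm_num
    · rw [ce, hfin.csSup_lt_iff hne]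
      rintro r ⟨x, hx, hxw, rfl⟩
      rw [← not_le, three_le_wexp_iff hx]
      exact h x hx hxw

theorem ce_lt_three_iff_noCube (w : List Bool) :
    ce w < 3 ↔ NoCube (fun j => w.getD j false) w.length := by
  rw [ce_lt_three_iff]
  constructor
  · intro h i p hp hN hc
    have hlen : ((w.drop i).take (3 * p)).length = 3 * p := by
      rw [List.length_take, List.length_drop]
      omega
    have hne : (w.drop i).take (3 * p) ≠ [] := List.ne_nil_of_length_pos (by omega)
    refine h _ hne ((List.take_prefix _ _).isInfix.trans (List.drop_suffix _ _).isInfix) ?_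
    have : per ((w.drop i).take (3 * p)) ≤ p := by
      refine Nat.sInf_le ⟨hp, by omega, fun j hj => ?_⟩
      have := hc (i + j) (by omega) (by omega)
      rw [hlen] at hj
      simp only [List.getD_eq_getElem?_getD] at this ⊢
      rw [List.getElem?_take_of_lt (by omega), List.getElem?_take_of_lt (by omega),
        List.getElem?_drop, List.getElem?_drop, this, add_assoc]
    omega
  · rintro h x hx ⟨s, u, rfl⟩ hle
    obtain ⟨h1, h2, h3⟩ := hasPeriodW_per hx
    refine h s.length (per x) h1 (by simp only [List.length_append]; omega) fun j hj hj' => ?_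
    have key : ∀ y, y < x.length → (s ++ x ++ u).getD (s.length + y) false = x.getD y false := by
      intro y hy
      simp only [List.getD_eq_getElem?_getD]
      rw [List.append_assoc, List.getElem?_append_right (by omega), Nat.add_sub_cancel_left,
        List.getElem?_append_left hy]
    have := h3 (j - s.length) (by omega)
    rw [← key _ (by omega), ← key _ (by omega)] at this
    simp only
    rwa [show s.length + (j - s.length) = j by omega,
      show s.length + (j - s.length + per x) = j + per x by omega] at this

theorem length_applyMorph_compl (h w : List Bool) :
    (applyMorph h (wcompl h) w).length = h.length * w.length := by
  induction w with
  | nil => simp [applyMorph]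
  | cons b w ih =>
    unfold applyMorph at ih ⊢
    rw [List.map_cons, List.flatten_cons, List.length_append, ih]
    cases b <;> simp [wcompl] <;> ring

theorem getD_applyMorph_compl {h : List Bool} (hh : 0 < h.length) (w : List Bool) :
    ∀ j, j < h.length * w.length → (applyMorph h (wcompl h) w).getD j false =
      xor (w.getD (j / h.length) false) (h.getD (j % h.length) false) := by
  induction w with
  | nil => intro j hj; simp at hj
  | cons b w ih =>
    intro j hj
    have e : applyMorph h (wcompl h) (b :: w) =
        (bif b then wcompl h else h) ++ applyMorph h (wcompl h) w := rfl
    have hl : (bif b then wcompl h else h).length = h.length := by cases b <;> simp [wcompl]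
    rw [e]
    by_cases hlt : j < h.length
    · rw [List.getD_append _ _ _ _ (by omega), Nat.div_eq_of_lt hlt, Nat.mod_eq_of_lt hlt]
      cases b <;> simp [wcompl, hlt]
    · rw [List.getD_append_right _ _ _ _ (by omega), hl]
      rw [List.length_cons, mul_add, mul_one] at hj
      rw [ih _ (by omega)]
      obtain ⟨y, rfl⟩ : ∃ y, j = y + h.length := ⟨j - h.length, by omega⟩
      rw [Nat.add_sub_cancel, Nat.add_div_right _ hh, Nat.add_mod_right, List.getD_cons_succ]

theorem NoCube.congr {g g' : ℕ → Bool} {N : ℕ} (hg : NoCube g N)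
    (h : ∀ j, j < N → g' j = g j) : NoCube g' N := by
  intro i p hp hN hc
  refine hg i p hp hN fun j hj hj' => ?_
  rw [← h j (by omega), ← h (j + p) (by omega)]
  exact hc j hj hj'

/-- for `k = m·2ⁿ` with `m` odd and `m ≡ 7 (mod 8)`, the clipped
Thue–Morse morphism `f_{6·2ⁿ, k}` is cubefree. -/
theorem stmt13 (m n k : ℕ) (hm : Odd m) (hm8 : m % 8 = 7) (hk : k = m * 2 ^ n) :
    CubefreeC (tmFactor (6 * 2 ^ n) k) := by
  subst hk
  intro w hw
  have hpos : 0 < m * 2 ^ n := Nat.mul_pos hm.pos (by positivity)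
  have hlen : (tmFactor (6 * 2 ^ n) (m * 2 ^ n)).length = m * 2 ^ n := by simp [tmFactor]
  rw [ce_lt_three_iff_noCube] at hw ⊢
  rw [length_applyMorph_compl, hlen]
  refine (noCube_clipped hm8 hw n).congr fun j hj => ?_
  rw [getD_applyMorph_compl (by omega) w j (by rwa [hlen]), hlen]
  simp [tmFactor, Nat.mod_lt j hpos]
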